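/- arXiv:1706.07991 — 4 statements merged into one kernel-verified Lean document; each statement's English description precedes it below -/
import Mathlib

section
/- Let 1 < α < 2, let x > 0, and let f : ℝ → ℝ be differentiable at 0. With j = j(h) = ⌊x/h⌋ + 1, the correction terms in the Grünwald formula for the Caputo derivative satisfy lim_{h→0⁺} h^{−α} · g^{α−2}_{j(h)+1} · ( f(x − (j(h)−1)·h) − f(x − j(h)·h) ) = f′(0) · x^{1−α}/Γ(2−α). -/
open Filter

/-- The Grünwald weights `g^α_i = (-1)^i (α choose i)`, defined by the recursion
`g^α_0 = 1`, `g^α_i = g^α_{i-1} · (i-1-α)/i` for `i ≥ 1`. -/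
noncomputable def grunwald (α : ℝ) : ℕ → ℝ
  | 0 => 1
  | (i + 1) => grunwald α i * ((i : ℝ) - α) / ((i : ℝ) + 1)

lemma grunwald_eq_GammaSeq (s : ℝ) (n : ℕ) (hn : 0 < n) :
    grunwald (-s) (n + 1) = (n : ℝ) ^ s / ((n : ℝ) + 1) * (Real.GammaSeq s n)⁻¹ := by
  have key : ∀ m : ℕ, grunwald (-s) m * (m.factorial : ℝ) = ∏ j ∈ Finset.range m, (s + (j : ℝ)) := by
    intro m
    induction m with
    | zero => simp [grunwald]
    | succ k ih =>
      rw [Finset.prod_range_succ, ← ih, Nat.factorial_succ, grunwald]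
      have : (k : ℝ) + 1 ≠ 0 := by positivity
      push_cast
      field_simp
      ring
  have h1 := key (n + 1)
  have hn' : (0 : ℝ) < n := by exact_mod_cast hn
  have h2 : (n : ℝ) ^ s ≠ 0 := (Real.rpow_pos_of_pos hn' s).ne'
  have h3 : (n.factorial : ℝ) ≠ 0 := by exact_mod_cast n.factorial_ne_zero
  have h4 : (n : ℝ) + 1 ≠ 0 := by positivity
  rw [Real.GammaSeq, ← h1, Nat.factorial_succ]
  push_cast
  field_simp

lemma grunwald_aux_slope (f : ℝ → ℝ) (hf : DifferentiableAt ℝ f 0) (a : ℝ → ℝ)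
    (ha : ∀ᶠ h in nhdsWithin (0 : ℝ) (Set.Ioi 0), 0 ≤ a h ∧ a h ≤ h) :
    Tendsto (fun h => (f (a h) - f (a h - h)) / h) (nhdsWithin 0 (Set.Ioi 0))
      (nhds (deriv f 0)) := by
  have hd := hf.hasDerivAt.isLittleO
  have h0 : Tendsto (fun h : ℝ => h) (nhdsWithin 0 (Set.Ioi 0)) (nhds 0) :=
    tendsto_nhdsWithin_of_tendsto_nhds tendsto_id
  have hta : Tendsto a (nhdsWithin 0 (Set.Ioi 0)) (nhds 0) :=
    tendsto_of_tendsto_of_tendsto_of_le_of_le' tendsto_const_nhds h0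
      (ha.mono fun _ h => h.1) (ha.mono fun _ h => h.2)
  have htb : Tendsto (fun h => a h - h) (nhdsWithin 0 (Set.Ioi 0)) (nhds 0) := by
    simpa using hta.sub h0
  have A := (hd.comp_tendsto hta).trans_isBigO (k := fun h : ℝ => h)
    (Asymptotics.IsBigO.of_bound 1 (by
      filter_upwards [ha] with h hh
      simp only [Function.comp, sub_zero, Real.norm_eq_abs, one_mul]
      rw [abs_of_nonneg hh.1, abs_of_nonneg (hh.1.trans hh.2)]; exact hh.2))
  have B := (hd.comp_tendsto htb).trans_isBigO (k := fun h : ℝ => h)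
    (Asymptotics.IsBigO.of_bound 1 (by
      filter_upwards [ha] with h hh
      simp only [Function.comp, sub_zero, Real.norm_eq_abs, one_mul]
      rw [abs_of_nonpos (by linarith), abs_of_nonneg (hh.1.trans hh.2)]; linarith))
  have C := ((A.sub B).tendsto_div_nhds_zero).add_const (deriv f 0)
  rw [zero_add] at C
  refine C.congr' ?_
  filter_upwards [self_mem_nhdsWithin] with h hh
  have : h ≠ 0 := ne_of_gt hh
  simp only [Function.comp, smul_eq_mul]
  field_simp
  ring

/-- For `1 < α < 2`, `x > 0`, `f` differentiable at `0`, and `j(h) = ⌊x/h⌋ + 1`,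
`h^{-α} · g^{α-2}_{j(h)+1} · (f(x − (j(h)−1)h) − f(x − j(h)h)) → f′(0) · x^{1−α}/Γ(2−α)`
as `h → 0⁺`. -/
theorem grunwald_correction_term_Caputo (α : ℝ) (hα₁ : 1 < α) (hα₂ : α < 2)
    (x : ℝ) (hx : 0 < x) (f : ℝ → ℝ) (hf : DifferentiableAt ℝ f 0) :
    Tendsto
      (fun h : ℝ =>
        h ^ (-α) * grunwald (α - 2) (⌊x / h⌋₊ + 1 + 1) *
          (f (x - (⌊x / h⌋₊ : ℝ) * h) - f (x - ((⌊x / h⌋₊ : ℝ) + 1) * h)))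
      (nhdsWithin 0 (Set.Ioi 0))
      (nhds (deriv f 0 * x ^ (1 - α) / Real.Gamma (2 - α))) := by
  have hfl : ∀ h : ℝ, 0 < h → 0 ≤ x - (⌊x / h⌋₊ : ℝ) * h ∧ x - (⌊x / h⌋₊ : ℝ) * h ≤ h := by
    intro h hh
    have h1 := Nat.floor_le (div_pos hx hh).le
    have h2 := (Nat.lt_floor_add_one (x / h)).le
    rw [le_div_iff₀ hh] at h1
    rw [div_le_iff₀ hh] at h2
    constructor <;> linarith
  have hpos : ∀ᶠ h in nhdsWithin (0 : ℝ) (Set.Ioi 0), 0 < h := self_mem_nhdsWithin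
  have S := grunwald_aux_slope f hf (fun h => x - (⌊x / h⌋₊ : ℝ) * h)
    (hpos.mono hfl)
  have h0 : Tendsto (fun h : ℝ => h) (nhdsWithin 0 (Set.Ioi 0)) (nhds 0) :=
    tendsto_nhdsWithin_of_tendsto_nhds tendsto_id
  have hN : Tendsto (fun h : ℝ => ⌊x / h⌋₊ + 1) (nhdsWithin 0 (Set.Ioi 0)) atTop := by
    refine (tendsto_add_atTop_nat 1).comp (tendsto_nat_floor_atTop.comp ?_)
    exact (tendsto_inv_nhdsGT_zero.const_mul_atTop hx).congr fun h => (div_eq_mul_inv x h).symm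
  have G := ((Real.GammaSeq_tendsto_Gamma (2 - α)).comp hN).inv₀
    (Real.Gamma_pos_of_pos (by linarith)).ne'
  have R := (tendsto_natCast_div_add_atTop (1 : ℝ)).comp hN
  have P0 : Tendsto (fun h : ℝ => h * ((⌊x / h⌋₊ + 1 : ℕ) : ℝ)) (nhdsWithin 0 (Set.Ioi 0))
      (nhds x) := by
    refine tendsto_of_tendsto_of_tendsto_of_le_of_le' tendsto_const_nhds
      (h := fun h => x + h) (by simpa using h0.const_add x) ?_ ?_
    · filter_upwards [hpos] with h hh
      have := hfl h hh
      push_cast; linarith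
    · filter_upwards [hpos] with h hh
      have := hfl h hh
      push_cast; linarith
  have P := P0.rpow_const (p := 1 - α) (Or.inl hx.ne')
  have T := ((P.mul R).mul G).mul S
  have e : deriv f 0 * x ^ (1 - α) / Real.Gamma (2 - α)
      = x ^ (1 - α) * 1 * (Real.Gamma (2 - α))⁻¹ * deriv f 0 := by
    rw [div_eq_mul_inv]; ring
  rw [e]
  refine T.congr' ?_
  filter_upwards [hpos] with h hh
  have hg := grunwald_eq_GammaSeq (2 - α) (⌊x / h⌋₊ + 1) (Nat.succ_pos _)
  rw [neg_sub] at hg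
  rw [hg]
  have hb : x - ((⌊x / h⌋₊ : ℝ) + 1) * h = x - (⌊x / h⌋₊ : ℝ) * h - h := by ring
  rw [hb]
  have hn : (0 : ℝ) < ((⌊x / h⌋₊ + 1 : ℕ) : ℝ) := by positivity
  simp only [Function.comp]
  generalize ((⌊x / h⌋₊ + 1 : ℕ) : ℝ) = n at hn ⊢
  rw [Real.mul_rpow hh.le hn.le]
  have e1 : h ^ (1 - α) = h * h ^ (-α) := by
    rw [sub_eq_add_neg, Real.rpow_add hh, Real.rpow_one]
  have e2 : n ^ (2 - α) = n * n ^ (1 - α) := by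
    rw [show 2 - α = 1 + (1 - α) by ring, Real.rpow_add hn, Real.rpow_one]
  rw [e1, e2]
  field_simp
end

section
/- Let 1 < α < 2, let n ≥ 2 be an integer, and let β > 0 satisfy α·β ≤ 1. Let B = (b_{ij})_{0≤i,j≤n} be the iteration matrix of the explicit Euler scheme for the Riemann–Liouville fractional diffusion equation with absorbing boundary conditions: b_{ij} = g^α_{j−i+1} if 0 < j < n and i ≤ j+1, and b_{ij} = 0 otherwise. If u ∈ ℝ^{n+1} has nonnegative entries and u_0 = u_n = 0, then the vector v with entries v_j = u_j + β·∑_{i=0}^n b_{ij}·u_i has nonnegative entries and satisfies v_0 = v_n = 0. That is, the explicit Euler scheme with absorbing boundary conditions is positivity preserving under the step size condition α·β ≤ 1. -/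
open Finset

theorem grunwald_add_two_nonneg (α : ℝ) (hα₁ : 1 < α) (hα₂ : α < 2) (k : ℕ) :
    0 ≤ grunwald α (k + 2) := by
  induction k with
  | zero =>
    simp only [grunwald]
    norm_num
    nlinarith
  | succ k ih =>
    rw [show k + 1 + 2 = (k + 2) + 1 from rfl, grunwald]
    have hk : (0 : ℝ) ≤ k := Nat.cast_nonneg k
    apply div_nonneg
    · apply mul_nonneg ih
      push_cast
      linarith
    · positivity

/-- The explicit Euler scheme for the Riemann–Liouville fractional diffusion
equation with absorbing boundary conditions is positivity preserving under the
step size condition `α·β ≤ 1`: the iteration matrix has entries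
`b_{ij} = g^α_{j−i+1}` if `0 < j < n` and `i ≤ j+1`, and `b_{ij} = 0` otherwise;
if `u ≥ 0` with `u_0 = u_n = 0`, then `v_j = u_j + β ∑_i b_{ij} u_i` is
nonnegative with `v_0 = v_n = 0`. -/
theorem euler_absorbing_positivity (α : ℝ) (hα₁ : 1 < α) (hα₂ : α < 2)
    (n : ℕ) (hn : 2 ≤ n) (β : ℝ) (hβ : 0 < β) (hstep : α * β ≤ 1)
    (b : Fin (n + 1) → Fin (n + 1) → ℝ)
    (hb : ∀ i j : Fin (n + 1), b i j =
      if 0 < (j : ℕ) ∧ (j : ℕ) < n ∧ (i : ℕ) ≤ (j : ℕ) + 1 then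
        grunwald α ((j : ℕ) + 1 - (i : ℕ)) else 0)
    (u : Fin (n + 1) → ℝ) (hu : ∀ i, 0 ≤ u i)
    (hu0 : u 0 = 0) (hun : u (Fin.last n) = 0) :
    (∀ j, 0 ≤ u j + β * ∑ i, b i j * u i) ∧
    u 0 + β * ∑ i, b i 0 * u i = 0 ∧
    u (Fin.last n) + β * ∑ i, b i (Fin.last n) * u i = 0 := by
  have hoff : ∀ i j : Fin (n + 1), i ≠ j → 0 ≤ b i j := by
    intro i j hij
    rw [hb]
    split_ifs with h
    · have hne : (i : ℕ) ≠ j := fun h' => hij (Fin.ext h')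
      rcases Nat.lt_or_ge (j : ℕ) i with hlt | hge
      · have h0 : (j : ℕ) + 1 - i = 0 := by omega
        rw [h0]
        simp [grunwald]
      · obtain ⟨k, hk⟩ : ∃ k, (j : ℕ) + 1 - i = k + 2 := ⟨(j : ℕ) - 1 - i, by omega⟩
        rw [hk]
        exact grunwald_add_two_nonneg α hα₁ hα₂ k
    · exact le_rfl
  have hdiag : ∀ j : Fin (n + 1), -α ≤ b j j := by
    intro j
    rw [hb]
    split_ifs with h
    · have h1 : (j : ℕ) + 1 - j = 1 := by omega
      rw [h1]
      simp [grunwald]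
    · linarith
  refine ⟨fun j => ?_, ?_, ?_⟩
  · have hsum : -α * u j ≤ ∑ i, b i j * u i := by
      rw [← Finset.add_sum_erase _ _ (Finset.mem_univ j)]
      have h1 : 0 ≤ ∑ i ∈ Finset.univ.erase j, b i j * u i :=
        Finset.sum_nonneg fun i hi =>
          mul_nonneg (hoff i j (Finset.ne_of_mem_erase hi)) (hu i)
      have h2 := mul_le_mul_of_nonneg_right (hdiag j) (hu j)
      linarith
    have h3 := mul_le_mul_of_nonneg_left hsum hβ.le
    have h4 := mul_le_mul_of_nonneg_right hstep (hu j)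
    linarith
  · simp [hb, hu0]
  · simp [hb, hun]
end

section
/- Let 1 < α < 2 and let n ≥ 2 be an integer. Let B = (b_{ij})_{0≤i,j≤n} be the iteration matrix of the explicit Euler scheme for the Riemann–Liouville fractional diffusion equation with reflecting boundary conditions: b_{ij} = g^α_{j−i+1} if 0 < j < n and i ≤ j+1; b_{10} = 1; b_{00} = 1−α; b_{in} = −g^{α−1}_{n−i} for 0 ≤ i ≤ n; and b_{ij} = 0 otherwise. Then every row sum of B is zero: ∑_{j=0}^n b_{ij} = 0 for each 0 ≤ i ≤ n. Consequently the reflecting scheme is mass preserving. -/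
open Finset

theorem grunwald_succ_eq (α : ℝ) (m : ℕ) :
    grunwald α (m + 1) = -α / ((m : ℝ) + 1) * grunwald (α - 1) m := by
  induction m with
  | zero => simp [grunwald]
  | succ k ih =>
    rw [grunwald, ih, grunwald]
    have h1 : (k : ℝ) + 1 ≠ 0 := by positivity
    have h2 : (k : ℝ) + 1 + 1 ≠ 0 := by positivity
    push_cast
    field_simp
    ring

theorem grunwald_pascal (α : ℝ) (m : ℕ) :
    grunwald (α - 1) m + grunwald α (m + 1) = grunwald (α - 1) (m + 1) := by
  rw [grunwald_succ_eq, grunwald]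
  have h1 : (m : ℝ) + 1 ≠ 0 := by positivity
  field_simp
  ring

/-- Partial row sums over the columns `0, …, N`. -/
theorem partial_row_sum (α : ℝ) (i N : ℕ) :
    ∑ j ∈ Finset.range (N + 1), (if 0 < j then
        (if i ≤ j + 1 then grunwald α (j + 1 - i) else 0)
      else (if i = 1 then 1 else if i = 0 then 1 - α else 0)) =
    if i ≤ N + 1 then grunwald (α - 1) (N + 1 - i) else 0 := by
  induction N with
  | zero =>
    rcases i with _ | _ | i <;> simp [grunwald]
  | succ N ih =>
    rw [Finset.sum_range_succ, ih, if_pos (Nat.succ_pos N)]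
    by_cases h : i ≤ N + 1
    · rw [if_pos h, if_pos (by omega), if_pos (by omega)]
      have : N + 1 + 1 - i = (N + 1 - i) + 1 := by omega
      rw [this, grunwald_pascal]
    · by_cases h' : i = N + 2
      · subst h'
        simp [grunwald]
      · rw [if_neg h, if_neg (by omega), if_neg (by omega), add_zero]

/-- The iteration matrix of the explicit Euler scheme for the Riemann–Liouville
fractional diffusion equation with reflecting boundary conditions
(`b_{ij} = g^α_{j−i+1}` for `0 < j < n`, `i ≤ j+1`; `b_{10} = 1`;
`b_{00} = 1−α`; `b_{in} = −g^{α−1}_{n−i}` for `0 ≤ i ≤ n`; `b_{ij} = 0`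
otherwise) has all row sums equal to zero, so the scheme is mass preserving. -/
theorem euler_reflecting_mass_preserving (α : ℝ) (hα₁ : 1 < α) (hα₂ : α < 2)
    (n : ℕ) (hn : 2 ≤ n)
    (b : Fin (n + 1) → Fin (n + 1) → ℝ)
    (hb : ∀ i j : Fin (n + 1), b i j =
      if 0 < (j : ℕ) ∧ (j : ℕ) < n then
        (if (i : ℕ) ≤ (j : ℕ) + 1 then grunwald α ((j : ℕ) + 1 - (i : ℕ)) else 0)
      else if (j : ℕ) = 0 then
        (if (i : ℕ) = 1 then 1 else if (i : ℕ) = 0 then 1 - α else 0)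
      else -grunwald (α - 1) (n - (i : ℕ))) :
    ∀ i, ∑ j, b i j = 0 := by
  intro i
  obtain ⟨N, rfl⟩ : ∃ N, n = N + 1 := ⟨n - 1, by omega⟩
  have hi : (i : ℕ) ≤ N + 1 := by omega
  rw [Fin.sum_univ_castSucc]
  have h1 : ∑ j : Fin (N + 1), b i j.castSucc =
      ∑ j ∈ Finset.range (N + 1), (if 0 < j then
        (if (i : ℕ) ≤ j + 1 then grunwald α (j + 1 - (i : ℕ)) else 0)
      else (if (i : ℕ) = 1 then 1 else if (i : ℕ) = 0 then 1 - α else 0)) := by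
    rw [Finset.sum_range]
    refine Finset.sum_congr rfl fun j _ => ?_
    rw [hb, Fin.val_castSucc]
    have hj := j.isLt
    by_cases h0 : 0 < (j : ℕ)
    · rw [if_pos ⟨h0, hj⟩, if_pos h0]
    · rw [if_neg (fun h => h0 h.1), if_neg h0, if_pos (by omega)]
  rw [h1, partial_row_sum, if_pos hi, hb, Fin.val_last,
    if_neg (by omega), if_neg (by omega)]
  ring
end

section
/- Let 1 < α < 2 and let n ≥ 2 be an integer. Let B = (b_{ij})_{0≤i,j≤n} be the iteration matrix of the explicit Euler scheme for the fractional diffusion equation with Caputo flux and reflecting boundary conditions: b_{ij} = g^α_{j−i+1} if 0 < j < n and 0 < i ≤ j+1; b_{10} = 1; b_{00} = −1; b_{0j} = −g^{α−1}_j for 0 < j < n; b_{0n} = g^{α−2}_{n−1}; b_{in} = −g^{α−1}_{n−i} for 0 < i ≤ n; and b_{ij} = 0 otherwise. Then every row sum of B is zero: ∑_{j=0}^n b_{ij} = 0 for each 0 ≤ i ≤ n. Consequently the Caputo-flux reflecting scheme is mass preserving. -/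
open Finset

lemma grunwald_succ_shift (a : ℝ) (m : ℕ) :
    grunwald a (m + 1) * ((m : ℝ) + 1) = -a * grunwald (a - 1) m := by
  induction m with
  | zero => simp [grunwald]
  | succ m ih =>
    have h1 : (m : ℝ) + 1 ≠ 0 := by positivity
    have h2 : (m : ℝ) + 1 + 1 ≠ 0 := by positivity
    rw [grunwald, grunwald.eq_2 (a - 1) m]
    push_cast
    field_simp
    linear_combination ((m : ℝ) + 1 - a) * ih

lemma grunwald_sum (a : ℝ) (m : ℕ) :
    ∑ j ∈ Finset.range (m + 1), grunwald a j = grunwald (a - 1) m := by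
  induction m with
  | zero => simp [grunwald]
  | succ m ih =>
    have h1 : (m : ℝ) + 1 ≠ 0 := by positivity
    have h := grunwald_succ_shift a m
    rw [Finset.sum_range_succ, ih, grunwald.eq_2 (a - 1) m, eq_div_iff h1]
    linear_combination h

/-- The iteration matrix of the explicit Euler scheme for the fractional
diffusion equation with Caputo flux and reflecting boundary conditions
(`b_{ij} = g^α_{j−i+1}` for `0 < j < n`, `0 < i ≤ j+1`; `b_{10} = 1`;
`b_{00} = −1`; `b_{0j} = −g^{α−1}_j` for `0 < j < n`; `b_{0n} = g^{α−2}_{n−1}`;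
`b_{in} = −g^{α−1}_{n−i}` for `0 < i ≤ n`; `b_{ij} = 0` otherwise) has all row
sums equal to zero, so the scheme is mass preserving. -/
theorem euler_caputo_reflecting_mass_preserving (α : ℝ) (hα₁ : 1 < α) (hα₂ : α < 2)
    (n : ℕ) (hn : 2 ≤ n)
    (b : Fin (n + 1) → Fin (n + 1) → ℝ)
    (hb : ∀ i j : Fin (n + 1), b i j =
      if (i : ℕ) = 0 then
        (if (j : ℕ) = 0 then -1
         else if (j : ℕ) < n then -grunwald (α - 1) (j : ℕ)
         else grunwald (α - 2) (n - 1))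
      else if (j : ℕ) = 0 then (if (i : ℕ) = 1 then 1 else 0)
      else if (j : ℕ) < n then
        (if (i : ℕ) ≤ (j : ℕ) + 1 then grunwald α ((j : ℕ) + 1 - (i : ℕ)) else 0)
      else -grunwald (α - 1) (n - (i : ℕ))) :
    ∀ i, ∑ j, b i j = 0 := by
  intro i
  obtain ⟨i, hi⟩ := i
  simp only [hb]
  rcases i with _ | k
  · obtain ⟨m, rfl⟩ : ∃ m, n = m + 1 := ⟨n - 1, by omega⟩
    rw [Fin.sum_univ_castSucc, Fin.sum_univ_succ]
    have h := grunwald_sum (α - 1) m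
    rw [Finset.sum_range_succ', Finset.sum_range] at h
    have e : α - 1 - 1 = α - 2 := by ring
    rw [e] at h
    simp [← h, grunwald]
  · obtain ⟨m, rfl⟩ : ∃ m, n = k + (m + 1) := ⟨n - 1 - k, by omega⟩
    rw [Fin.sum_univ_castSucc]
    have h := grunwald_sum α m
    have h2 : ∑ j ∈ Finset.range (k + (m + 1)),
        (if k + 1 ≤ j + 1 then grunwald α (j + 1 - (k + 1)) else 0) = grunwald (α - 1) m := by
      rw [Finset.sum_range_add, Finset.sum_eq_zero, zero_add, ← h]
      · refine Finset.sum_congr rfl fun j _ => ?_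
        rw [if_pos (by omega)]
        congr 1
        omega
      · intro j hj
        rw [Finset.mem_range] at hj
        rw [if_neg (by omega)]
    rw [Finset.sum_range] at h2
    have h3 : k + (m + 1) - (k + 1) = m := by omega
    simp only [Fin.val_castSucc, Fin.val_last, h3, lt_irrefl, if_false, if_neg (Nat.succ_ne_zero k)]
    rw [if_neg (show ¬ k + (m + 1) = 0 by omega), add_neg_eq_zero, ← h2]
    refine Finset.sum_congr rfl fun j _ => ?_
    have hj := j.isLt
    by_cases h0 : (j : ℕ) = 0
    · rw [if_pos h0, h0]
      by_cases hk : k = 0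
      · simp [hk, grunwald]
      · rw [if_neg (by omega), if_neg (by omega)]
    · rw [if_neg h0, if_pos hj]
end
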